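/- In every state reached along an asynchronous execution of the two-agent exploration algorithm, every edge {u,v} of G satisfies exactly one of the following: both of its darts are marked ∅ and it has never been traversed; both of its darts have markers in {B, E, F} and it has been traversed exactly once; both of its darts are marked D and it has been traversed exactly twice. -/

import Mathlib

/-!
Two-agent asynchronous collective exploration.  Markers:
`none` (unmarked), `E` (Explored), `B` (Backtrack), `F` (First entry),
`D` (Done, traversed twice).  A state records the marking, the positions of
the two agents and the set of visited vertices.
-/

namespace TwoExplore

inductive Mk : Type
  | none | E | B | F | D
  deriving DecidableEq

structure St (V : Type*) where
  μ : V → V → Mk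
  p1 : V
  p2 : V
  vis : Set V

variable {V : Type*} [DecidableEq V]

/-- Update the marker of the dart `(u, v)`. -/
def upd (μ : V → V → Mk) (u v : V) (c : Mk) : V → V → Mk :=
  fun a b => if a = u ∧ b = v then c else μ a b

/-- Position of agent `b` (`true` = first agent, `false` = second agent). -/
def pos (s : St V) (b : Bool) : V := if b then s.p1 else s.p2

/-- The state obtained from `s` by moving agent `b` to `v`, with new marking
`μ'` and new visited set `vis'`. -/
def moveTo (s : St V) (b : Bool) (v : V) (μ' : V → V → Mk) (vis' : Set V) : St V :=
  ⟨μ', if b then v else s.p1, if b then s.p2 else v, vis'⟩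

/-- One asynchronous move: agent `b` applies the first applicable rule
(R1)–(R5); the label records the agent and the traversed dart. -/
inductive Step (G : SimpleGraph V) : St V → Bool × (V × V) → St V → Prop
  | r1 (s : St V) (b : Bool) (v : V) (hadj : G.Adj (pos s b) v)
      (hB : s.μ (pos s b) v = Mk.B) :
      Step G s (b, (pos s b, v))
        (moveTo s b v (upd (upd s.μ (pos s b) v Mk.D) v (pos s b) Mk.D) s.vis)
  | r2 (s : St V) (b : Bool) (v : V) (hadj : G.Adj (pos s b) v)
      (hnoB : ∀ w, G.Adj (pos s b) w → s.μ (pos s b) w ≠ Mk.B)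
      (h0 : s.μ (pos s b) v = Mk.none) (hE : s.μ v (pos s b) = Mk.E) :
      Step G s (b, (pos s b, v))
        (moveTo s b v (upd (upd s.μ (pos s b) v Mk.E) v (pos s b) Mk.D) s.vis)
  | r3_new (s : St V) (b : Bool) (v : V) (hadj : G.Adj (pos s b) v)
      (hnoB : ∀ w, G.Adj (pos s b) w → s.μ (pos s b) w ≠ Mk.B)
      (hnoRev : ∀ w, G.Adj (pos s b) w →
        ¬(s.μ (pos s b) w = Mk.none ∧ s.μ w (pos s b) = Mk.E))
      (h0 : s.μ (pos s b) v = Mk.none) (hv : v ∉ s.vis) :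
      Step G s (b, (pos s b, v))
        (moveTo s b v (upd (upd s.μ (pos s b) v Mk.E) v (pos s b) Mk.F)
          (insert v s.vis))
  | r3_old (s : St V) (b : Bool) (v : V) (hadj : G.Adj (pos s b) v)
      (hnoB : ∀ w, G.Adj (pos s b) w → s.μ (pos s b) w ≠ Mk.B)
      (hnoRev : ∀ w, G.Adj (pos s b) w →
        ¬(s.μ (pos s b) w = Mk.none ∧ s.μ w (pos s b) = Mk.E))
      (h0 : s.μ (pos s b) v = Mk.none) (hv : v ∈ s.vis) :
      Step G s (b, (pos s b, v))
        (moveTo s b v (upd (upd s.μ (pos s b) v Mk.E) v (pos s b) Mk.B)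
          (insert v s.vis))
  | r4 (s : St V) (b : Bool) (v : V) (hadj : G.Adj (pos s b) v)
      (hnoB : ∀ w, G.Adj (pos s b) w → s.μ (pos s b) w ≠ Mk.B)
      (hno0 : ∀ w, G.Adj (pos s b) w → s.μ (pos s b) w ≠ Mk.none)
      (hF : s.μ (pos s b) v = Mk.F) :
      Step G s (b, (pos s b, v))
        (moveTo s b v (upd (upd s.μ (pos s b) v Mk.D) v (pos s b) Mk.D) s.vis)
  | r5 (s : St V) (b : Bool) (v : V) (hadj : G.Adj (pos s b) v)
      (hnoB : ∀ w, G.Adj (pos s b) w → s.μ (pos s b) w ≠ Mk.B)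
      (hno0 : ∀ w, G.Adj (pos s b) w → s.μ (pos s b) w ≠ Mk.none)
      (hnoF : ∀ w, G.Adj (pos s b) w → s.μ (pos s b) w ≠ Mk.F)
      (hE : s.μ (pos s b) v = Mk.E) :
      Step G s (b, (pos s b, v))
        (moveTo s b v (upd (upd s.μ (pos s b) v Mk.D) v (pos s b) Mk.D) s.vis)

/-- The initial state: both agents at the origin `r`. -/
def init (r : V) : St V := ⟨fun _ _ => Mk.none, r, r, {r}⟩

/-- `f 0, …, f k` is an asynchronous execution, where at round `i` the
adversarially chosen agent `(lbl i).1` traverses the dart `(lbl i).2`. -/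
def IsExec (G : SimpleGraph V) (r : V) (k : ℕ) (f : ℕ → St V)
    (lbl : ℕ → Bool × (V × V)) : Prop :=
  f 0 = init r ∧ ∀ i < k, Step G (f i) (lbl i) (f (i + 1))

/-- Number of times the edge `{u, v}` has been traversed (in either direction)
during the first `i` moves. -/
def edgeCount (lbl : ℕ → Bool × (V × V)) (i : ℕ) (u v : V) : ℕ :=
  ((Finset.range i).filter fun j => (lbl j).2 = (u, v) ∨ (lbl j).2 = (v, u)).card

end TwoExplore

namespace TwoExplore

variable {V : Type*} [DecidableEq V]

lemma edgeCount_succ_of_traversed {lbl : ℕ → Bool × (V × V)} {i : ℕ} {u v : V}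
    (h : (lbl i).2 = (u, v) ∨ (lbl i).2 = (v, u)) :
    edgeCount lbl (i + 1) u v = edgeCount lbl i u v + 1 := by
  simp [edgeCount, Finset.range_add_one, Finset.filter_insert, h]

lemma edgeCount_succ_of_not_traversed {lbl : ℕ → Bool × (V × V)} {i : ℕ} {u v : V}
    (h : ¬((lbl i).2 = (u, v) ∨ (lbl i).2 = (v, u))) :
    edgeCount lbl (i + 1) u v = edgeCount lbl i u v := by
  simp [edgeCount, Finset.range_add_one, Finset.filter_insert, h]

lemma edgeCount_comm (lbl : ℕ → Bool × (V × V)) (i : ℕ) (u v : V) :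
    edgeCount lbl i u v = edgeCount lbl i v u := by
  simp only [edgeCount, or_comm]

/-- The marks `a`, `b` of the two darts of an edge agree with its having been traversed `n`
times. -/
def Consistent (a b : Mk) (n : ℕ) : Prop :=
  (a = Mk.none ∧ b = Mk.none ∧ n = 0) ∨
  ((a = Mk.B ∨ a = Mk.E ∨ a = Mk.F) ∧ (b = Mk.B ∨ b = Mk.E ∨ b = Mk.F) ∧ n = 1) ∨
  (a = Mk.D ∧ b = Mk.D ∧ n = 2)

lemma Consistent.symm {a b : Mk} {n : ℕ} (h : Consistent a b n) : Consistent b a n := by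
  unfold Consistent at *
  tauto

/-- A move along the dart `(p, q)` remarks only the two darts of that edge, and takes consistent
marks of that edge to marks consistent with one more traversal. -/
lemma Step.exists_marks {G : SimpleGraph V} {s t : St V} {l : Bool × (V × V)}
    (h : Step G s l t) :
    ∃ p q c d, G.Adj p q ∧ l.2 = (p, q) ∧ t.μ = upd (upd s.μ p q c) q p d ∧
      ∀ n, Consistent (s.μ p q) (s.μ q p) n → Consistent c d (n + 1) := by
  cases h <;> refine ⟨_, _, _, _, ‹_›, rfl, rfl, ?_⟩ <;> intro n hn <;>
    simp_all [Consistent]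

lemma consistent_succ {G : SimpleGraph V} {s t : St V} {lbl : ℕ → Bool × (V × V)} {i : ℕ}
    (h : Step G s (lbl i) t)
    (ih : ∀ u v, G.Adj u v → Consistent (s.μ u v) (s.μ v u) (edgeCount lbl i u v))
    (u v : V) (huv : G.Adj u v) :
    Consistent (t.μ u v) (t.μ v u) (edgeCount lbl (i + 1) u v) := by
  obtain ⟨p, q, c, d, hpq, hl, ht, hcd⟩ := h.exists_marks
  have key : Consistent (t.μ p q) (t.μ q p) (edgeCount lbl (i + 1) p q) := by
    rw [edgeCount_succ_of_traversed (Or.inl hl), ht]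
    simpa [upd, hpq.ne, hpq.ne'] using hcd _ (ih p q hpq)
  by_cases h₁ : p = u ∧ q = v
  · obtain ⟨rfl, rfl⟩ := h₁
    exact key
  by_cases h₂ : p = v ∧ q = u
  · obtain ⟨rfl, rfl⟩ := h₂
    rw [edgeCount_comm]
    exact key.symm
  have hne : ¬((lbl i).2 = (u, v) ∨ (lbl i).2 = (v, u)) := by
    simp [hl, h₁, h₂]
  rw [edgeCount_succ_of_not_traversed hne, ht]
  have e₁ : upd (upd s.μ p q c) q p d u v = s.μ u v := by
    grind [upd]
  have e₂ : upd (upd s.μ p q c) q p d v u = s.μ v u := by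
    grind [upd]
  rw [e₁, e₂]
  exact ih u v huv

end TwoExplore

open TwoExplore in
/-- Along any asynchronous execution of the two-agent
exploration algorithm, every edge satisfies exactly one of: both darts
unmarked and never traversed; both darts marked in `{B, E, F}` and traversed
exactly once; both darts marked `D` and traversed exactly twice. -/
theorem two_agent_edge_invariant {V : Type*} [Fintype V] [DecidableEq V]
    (G : SimpleGraph V) [Fintype G.edgeSet] (hG : G.Connected) (r : V)
    (k : ℕ) (f : ℕ → St V) (lbl : ℕ → Bool × (V × V))
    (hexec : IsExec G r k f lbl) :
    ∀ i ≤ k, ∀ u v : V, G.Adj u v →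
      ((f i).μ u v = Mk.none ∧ (f i).μ v u = Mk.none ∧ edgeCount lbl i u v = 0) ∨
      (((f i).μ u v = Mk.B ∨ (f i).μ u v = Mk.E ∨ (f i).μ u v = Mk.F) ∧
        ((f i).μ v u = Mk.B ∨ (f i).μ v u = Mk.E ∨ (f i).μ v u = Mk.F) ∧
        edgeCount lbl i u v = 1) ∨
      ((f i).μ u v = Mk.D ∧ (f i).μ v u = Mk.D ∧ edgeCount lbl i u v = 2) := by
  intro i
  induction i with
  | zero =>
    intro _ u v _
    left
    simp [hexec.1, init, edgeCount]
  | succ i ih =>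
    intro hi
    exact consistent_succ (hexec.2 i (by omega)) (ih (by omega))
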